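/- arXiv:2508.20690 — 3 statements merged into one kernel-verified Lean document; each statement's English description precedes it below -/
import Mathlib

section
/- Let c₁, c₂, k₀, k₁ > 0, F(x) = c₁ ln x + c₂ x and g(x) = (k₀ + k₁ x)/(c₁ + c₂ x). For all s, t > 0 one has |g(s) − g(t)| ≤ (|k₁ c₁ − k₀ c₂| / (c₁² c₂)) · |F(s) − F(t)|. Equivalently, the composition g ∘ G, where G = F⁻¹ : ℝ → (0, ∞), is Lipschitz continuous on ℝ with constant |k₁ c₁ − k₀ c₂| / (c₁² c₂). -/
/-- Adding `a * log x` with `0 ≤ a` to `b * x` keeps `b` as a lower bound for the slope. -/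
lemma mul_abs_sub_le_abs_log_add_mul_sub {a b s t : ℝ} (ha : 0 ≤ a)
    (hs : 0 < s) (ht : 0 < t) :
    b * |s - t| ≤ |(a * Real.log s + b * s) - (a * Real.log t + b * t)| := by
  wlog hst : t ≤ s generalizing s t
  · rw [abs_sub_comm s, abs_sub_comm (_ + _)]
    exact this ht hs (le_of_not_ge hst)
  have hlog : a * Real.log t ≤ a * Real.log s := by gcongr
  rw [abs_of_nonneg (sub_nonneg.2 hst)]
  exact le_trans (by linarith) (le_abs_self _)

/-- A Möbius function `x ↦ (k₀ + k₁ x) / (c₁ + c₂ x)` is Lipschitz on the positive half-line. -/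
lemma abs_moebius_sub_le {c₁ c₂ s t : ℝ} (k₀ k₁ : ℝ) (hc₁ : 0 < c₁) (hc₂ : 0 ≤ c₂)
    (hs : 0 ≤ s) (ht : 0 ≤ t) :
    |(k₀ + k₁ * s) / (c₁ + c₂ * s) - (k₀ + k₁ * t) / (c₁ + c₂ * t)| ≤
      |k₁ * c₁ - k₀ * c₂| / c₁ ^ 2 * |s - t| := by
  have hcs : c₁ ≤ c₁ + c₂ * s := le_add_of_nonneg_right (by positivity)
  have hct : c₁ ≤ c₁ + c₂ * t := le_add_of_nonneg_right (by positivity)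
  have hs' : 0 < c₁ + c₂ * s := hc₁.trans_le hcs
  have ht' : 0 < c₁ + c₂ * t := hc₁.trans_le hct
  have heq : (k₀ + k₁ * s) / (c₁ + c₂ * s) - (k₀ + k₁ * t) / (c₁ + c₂ * t) =
      (k₁ * c₁ - k₀ * c₂) * (s - t) / ((c₁ + c₂ * s) * (c₁ + c₂ * t)) := by
    rw [div_sub_div _ _ hs'.ne' ht'.ne']
    ring
  rw [heq, abs_div, abs_mul, abs_of_pos (mul_pos hs' ht'), div_mul_eq_mul_div, sq]
  gcongr

/-- Let `c₁, c₂, k₀, k₁ > 0`, `F x = c₁ * log x + c₂ * x` and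
`g x = (k₀ + k₁ x)/(c₁ + c₂ x)`. For all `s, t > 0` one has
`|g s - g t| ≤ (|k₁ c₁ - k₀ c₂| / (c₁² c₂)) * |F s - F t|`; equivalently, `g ∘ G`
(with `G = F⁻¹ : ℝ → (0, ∞)`) is Lipschitz on `ℝ` with constant
`|k₁ c₁ - k₀ c₂| / (c₁² c₂)`. -/
theorem g_comp_G_lipschitz (c₁ c₂ k₀ k₁ : ℝ) (hc₁ : 0 < c₁) (hc₂ : 0 < c₂)
    (hk₀ : 0 < k₀) (hk₁ : 0 < k₁) :
    (∀ s t : ℝ, 0 < s → 0 < t →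
      |(k₀ + k₁ * s) / (c₁ + c₂ * s) - (k₀ + k₁ * t) / (c₁ + c₂ * t)| ≤
        (|k₁ * c₁ - k₀ * c₂| / (c₁ ^ 2 * c₂)) *
          |(c₁ * Real.log s + c₂ * s) - (c₁ * Real.log t + c₂ * t)|) ∧
    (∀ G : ℝ → ℝ, (∀ v : ℝ, 0 < G v ∧ c₁ * Real.log (G v) + c₂ * G v = v) →
      ∀ u v : ℝ,
        |(k₀ + k₁ * G u) / (c₁ + c₂ * G u) - (k₀ + k₁ * G v) / (c₁ + c₂ * G v)| ≤
          (|k₁ * c₁ - k₀ * c₂| / (c₁ ^ 2 * c₂)) * |u - v|) := by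
  have key : ∀ s t : ℝ, 0 < s → 0 < t →
      |(k₀ + k₁ * s) / (c₁ + c₂ * s) - (k₀ + k₁ * t) / (c₁ + c₂ * t)| ≤
        (|k₁ * c₁ - k₀ * c₂| / (c₁ ^ 2 * c₂)) *
          |(c₁ * Real.log s + c₂ * s) - (c₁ * Real.log t + c₂ * t)| := by
    intro s t hs ht
    calc
      _ ≤ |k₁ * c₁ - k₀ * c₂| / c₁ ^ 2 * |s - t| :=
        abs_moebius_sub_le k₀ k₁ hc₁ hc₂.le hs.le ht.le
      _ = |k₁ * c₁ - k₀ * c₂| / (c₁ ^ 2 * c₂) * (c₂ * |s - t|) := by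
        field_simp
      _ ≤ _ := by
        gcongr
        exact mul_abs_sub_le_abs_log_add_mul_sub hc₁.le hs ht
  refine ⟨key, fun G hG u v => ?_⟩
  simpa only [(hG u).2, (hG v).2] using key (G u) (G v) (hG u).1 (hG v).1
end

section
/- Let ε > 0 and let u : ℝ³ × ℝ³ → [0, ∞] be a measurable function which is ℤ³-periodic in its second variable, i.e., u(x, y + k) = u(x, y) for all k ∈ ℤ³. Then, with Lebesgue measure throughout, ∫_{ℝ³} u(x, x/ε) dx = ∫_{[0,1]³} ∫_{ℝ³} u(ε⌊x/ε⌋ + ε y, y) dx dy, where ⌊·⌋ is applied componentwise. -/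
open MeasureTheory

theorem measurableSet_floor_fiber {ι : Type*} [Finite ι] (k : ι → ℤ) :
    MeasurableSet {x : ι → ℝ | ∀ i, ⌊x i⌋ = k i} := by
  simp only [Set.ofPred_forall]
  exact MeasurableSet.iInter fun i =>
    (Int.measurable_floor.comp (measurable_pi_apply i)) (measurableSet_singleton (k i))

theorem iUnion_floor_fiber {ι : Type*} :
    ⋃ k : ι → ℤ, {x : ι → ℝ | ∀ i, ⌊x i⌋ = k i} = Set.univ :=
  Set.eq_univ_of_forall fun x => Set.mem_iUnion.2 ⟨fun i => ⌊x i⌋, fun _ => rfl⟩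

theorem floor_fiber_zero_eq_pi_Ico {ι : Type*} :
    {x : ι → ℝ | ∀ i, ⌊x i⌋ = 0} = Set.univ.pi fun _ => Set.Ico 0 1 := by
  ext x
  simp [Int.floor_eq_zero_iff]

theorem volume_pi_Ico_zero_one {ι : Type*} [Fintype ι] :
    volume (Set.univ.pi fun _ : ι => Set.Ico (0 : ℝ) 1) = 1 := by
  rw [volume_pi_pi]
  simp

/-- The integral over `ℝ^ι` is the sum over `ℤ^ι` of the integrals over the translated
unit cells. -/
theorem lintegral_eq_tsum_lintegral_cell {ι : Type*} [Fintype ι] (g : (ι → ℝ) → ENNReal) :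
    ∫⁻ x, g x = ∑' k : ι → ℤ, ∫⁻ z in Set.univ.pi fun _ : ι => Set.Ico (0 : ℝ) 1,
      g (z + fun i => (k i : ℝ)) := by
  rw [← setLIntegral_univ, ← iUnion_floor_fiber,
    lintegral_iUnion measurableSet_floor_fiber]
  · refine tsum_congr fun k => ?_
    have hmp := measurePreserving_add_right (volume : Measure (ι → ℝ)) fun i => (k i : ℝ)
    rw [← hmp.setLIntegral_comp_preimage_emb
      (MeasurableEquiv.addRight (fun i => (k i : ℝ))).measurableEmbedding,
      ← floor_fiber_zero_eq_pi_Ico]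
    congr 2
    ext x
    simp
  · intro k l hkl
    refine Set.disjoint_left.2 fun x hk hl => hkl ?_
    funext i
    exact (hk i).symm.trans (hl i)

theorem lintegral_comp_div {ι : Type*} [Fintype ι] {ε : ℝ} (hε : 0 < ε)
    (g : (ι → ℝ) → ENNReal) (hg : Measurable g) :
    ∫⁻ x : ι → ℝ, g (fun i => x i / ε) = ENNReal.ofReal (ε ^ Fintype.card ι) * ∫⁻ z, g z := by
  have hmap := Measure.map_addHaar_smul (volume : Measure (ι → ℝ)) (inv_ne_zero hε.ne')
  have hdiv : ∀ x : ι → ℝ, (fun i => x i / ε) = ε⁻¹ • x := fun x => by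
    funext i
    simp [div_eq_inv_mul]
  simp only [hdiv]
  rw [← lintegral_map hg (measurable_const_smul ε⁻¹), hmap, lintegral_smul_measure]
  simp [abs_of_pos hε]

/-- A function of the componentwise floor integrates to the sum of its values. -/
theorem lintegral_comp_floor {ι : Type*} [Fintype ι] (g : (ι → ℤ) → ENNReal) :
    ∫⁻ x : ι → ℝ, g (fun i => ⌊x i⌋) = ∑' k, g k := by
  rw [lintegral_eq_tsum_lintegral_cell]
  refine tsum_congr fun k => ?_
  rw [setLIntegral_congr_fun (g := fun _ => g k)
    (MeasurableSet.univ_pi fun _ => measurableSet_Ico)]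
  · rw [setLIntegral_const, volume_pi_Ico_zero_one, mul_one]
  · intro z hz
    rw [← floor_fiber_zero_eq_pi_Ico] at hz
    have hfloor : ∀ i, ⌊z i⌋ = 0 := hz
    simp [hfloor]



/-- Unfolding identity: for `ε > 0` and a measurable `u : ℝ³ × ℝ³ → [0,∞]` that is
`ℤ³`-periodic in its second variable,
`∫_{ℝ³} u(x, x/ε) dx = ∫_{[0,1]³} ∫_{ℝ³} u(ε⌊x/ε⌋ + εy, y) dx dy`. -/
theorem unfolding_identity (ε : ℝ) (hε : 0 < ε)
    (u : (Fin 3 → ℝ) × (Fin 3 → ℝ) → ENNReal) (hu : Measurable u)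
    (hper : ∀ (x y : Fin 3 → ℝ) (k : Fin 3 → ℤ),
      u (x, y + fun i => (k i : ℝ)) = u (x, y)) :
    ∫⁻ x : Fin 3 → ℝ, u (x, fun i => x i / ε) ∂volume =
      ∫⁻ y in Set.Icc (0 : Fin 3 → ℝ) 1,
        (∫⁻ x : Fin 3 → ℝ, u ((fun i => ε * (⌊x i / ε⌋ : ℝ) + ε * y i), y) ∂volume)
        ∂volume := by
  have hfloor : Measurable fun z : Fin 3 → ℝ => fun i => ⌊z i⌋ :=
    measurable_pi_lambda _ fun i => Int.measurable_floor.comp (measurable_pi_apply i)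
  have hinner : ∀ y : Fin 3 → ℝ,
      ∫⁻ x : Fin 3 → ℝ, u ((fun i => ε * (⌊x i / ε⌋ : ℝ) + ε * y i), y) =
        ENNReal.ofReal (ε ^ 3) *
          ∑' k : Fin 3 → ℤ, u ((fun i => ε * (k i : ℝ) + ε * y i), y) := fun y => by
    have hdiv := lintegral_comp_div hε
      (fun z : Fin 3 → ℝ => u ((fun i => ε * (⌊z i⌋ : ℝ) + ε * y i), y))
      ((measurable_of_countable fun k : Fin 3 → ℤ =>
        u ((fun i => ε * (k i : ℝ) + ε * y i), y)).comp hfloor)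
    rw [hdiv, lintegral_comp_floor fun k : Fin 3 → ℤ =>
      u ((fun i => ε * (k i : ℝ) + ε * y i), y), Fintype.card_fin]
  have hmeas : ∀ k : Fin 3 → ℤ, Measurable fun y : Fin 3 → ℝ =>
      u ((fun i => ε * (k i : ℝ) + ε * y i), y) := fun k => hu.comp (by fun_prop)
  have houter := lintegral_comp_div hε (fun z : Fin 3 → ℝ => u (fun i => ε * z i, z))
    (hu.comp (by fun_prop))
  simp only [mul_div_cancel₀ _ hε.ne', Fintype.card_fin] at houter
  have hcell : (Set.univ.pi fun _ : Fin 3 => Set.Ico (0 : ℝ) 1) =ᵐ[volume]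
      Set.Icc (0 : Fin 3 → ℝ) 1 := Measure.univ_pi_Ico_ae_eq_Icc
  simp only [hinner]
  rw [lintegral_const_mul _ (Measurable.tsum hmeas),
    lintegral_tsum fun k => (hmeas k).aemeasurable]
  refine houter.trans ?_
  rw [lintegral_eq_tsum_lintegral_cell]
  congr 1
  refine tsum_congr fun k => ?_
  rw [setLIntegral_congr hcell]
  refine lintegral_congr fun z => ?_
  rw [hper]
  congr 2
  funext i
  simp only [Pi.add_apply]
  ring
end

section
/- Let f : ℝ³ → ℝ be continuous and ℤ³-periodic (f(y + k) = f(y) for all k ∈ ℤ³), and let φ : ℝ³ → ℝ be continuous with compact support. Then, as ε → 0⁺, ∫_{ℝ³} φ(x) f(x/ε) dx → (∫_{[0,1]³} f(y) dy) · (∫_{ℝ³} φ(x) dx). -/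
open MeasureTheory Filter

section Periodic

variable {ι : Type*} {f : (ι → ℝ) → ℝ}

/-- The integral of a `ℤ^ι`-periodic function over a translate of the unit cell does not depend on
the translate. -/
theorem setIntegral_unitCell_add_of_periodic [Fintype ι]
    (hper : ∀ (y : ι → ℝ) (k : ι → ℤ), f (y + fun i => (k i : ℝ)) = f y) (a : ι → ℝ) :
    ∫ t in Set.Icc (0 : ι → ℝ) 1, f (a + t) = ∫ t in Set.Icc (0 : ι → ℝ) 1, f t := by
  have hD := ZSpan.isAddFundamentalDomain (Pi.basisFun ℝ ι) volume
  have hae : ZSpan.fundamentalDomain (Pi.basisFun ℝ ι) =ᵐ[volume] Set.Icc (0 : ι → ℝ) 1 := by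
    rw [ZSpan.fundamentalDomain_pi_basisFun]
    exact Measure.univ_pi_Ico_ae_eq_Icc
  rw [← setIntegral_congr_set hae, ← setIntegral_congr_set hae,
    ← (measurePreserving_add_left volume a).setIntegral_image_emb
      (measurableEmbedding_addLeft a)]
  have : VAddInvariantMeasure (Submodule.span ℤ (Set.range (Pi.basisFun ℝ ι))) (ι → ℝ) volume :=
    inferInstanceAs <| VAddInvariantMeasure
      (Submodule.span ℤ (Set.range (Pi.basisFun ℝ ι))).toAddSubgroup (ι → ℝ) volume
  refine (hD.vadd_of_comm a).setIntegral_eq hD fun g x => ?_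
  choose k hk using ((Pi.basisFun ℝ ι).mem_span_iff_repr_mem ℤ g.1).1 g.2
  have hg : (g : ι → ℝ) = fun i => (k i : ℝ) := funext fun i => by simpa using (hk i).symm
  rw [Submodule.vadd_def, hg, vadd_eq_add, add_comm, hper]

/-- A continuous `ℤ^ι`-periodic function is bounded. -/
theorem exists_norm_le_of_continuous_periodic (hf : Continuous f)
    (hper : ∀ (y : ι → ℝ) (k : ι → ℤ), f (y + fun i => (k i : ℝ)) = f y) :
    ∃ C : ℝ, ∀ y, ‖f y‖ ≤ C := by
  obtain ⟨C, hC⟩ := (isCompact_Icc (a := (0 : ι → ℝ)) (b := 1)).exists_bound_of_continuousOn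
    hf.continuousOn
  refine ⟨C, fun y => ?_⟩
  rw [← hper y fun i => -⌊y i⌋]
  refine hC _ ⟨fun i => ?_, fun i => ?_⟩
  · simpa using Int.floor_le (y i)
  · simpa [add_comm] using (Int.lt_floor_add_one (y i)).le

/-- Averaging over all translates by vectors of the unit cell replaces a bounded periodic factor
by its mean. -/
theorem setIntegral_integral_mul_periodic [Fintype ι] (hf : Continuous f)
    (hper : ∀ (y : ι → ℝ) (k : ι → ℤ), f (y + fun i => (k i : ℝ)) = f y)
    {φ : (ι → ℝ) → ℝ} (hφ : Integrable φ) {T : (ι → ℝ) → ι → ℝ} (hT : Continuous T) :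
    IntegrableOn (fun t => ∫ y, φ y * f (T y + t)) (Set.Icc (0 : ι → ℝ) 1) ∧
    ∫ t in Set.Icc (0 : ι → ℝ) 1, ∫ y, φ y * f (T y + t) =
      (∫ t in Set.Icc (0 : ι → ℝ) 1, f t) * ∫ y, φ y := by
  obtain ⟨C, hC⟩ := exists_norm_le_of_continuous_periodic hf hper
  have : IsFiniteMeasure (volume.restrict (Set.Icc (0 : ι → ℝ) 1)) :=
    ⟨by simpa using isCompact_Icc.measure_lt_top⟩
  have hint : Integrable (fun p : (ι → ℝ) × (ι → ℝ) => φ p.2 * f (T p.2 + p.1))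
      ((volume.restrict (Set.Icc (0 : ι → ℝ) 1)).prod volume) :=
    (hφ.comp_snd _).mul_bdd (c := C)
      (Continuous.aestronglyMeasurable (by fun_prop)) (ae_of_all _ fun p => hC _)
  refine ⟨hint.integral_prod_left, ?_⟩
  rw [integral_integral_swap hint, ← integral_const_mul]
  refine integral_congr_ae (ae_of_all _ fun y => ?_)
  simp only
  rw [integral_const_mul, setIntegral_unitCell_add_of_periodic hper, mul_comm]

end Periodic

/-- Continuity of translations in `L¹` for continuous compactly supported functions, tested
against uniformly bounded functions. -/
theorem exists_forall_norm_integral_translate_sub_mul_le {ι : Type*} [Fintype ι]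
    {φ : (ι → ℝ) → ℝ} (hφ : Continuous φ) (hsupp : HasCompactSupport φ) (C : ℝ)
    {η : ℝ} (hη : 0 < η) :
    ∃ δ > 0, ∀ v : ι → ℝ, ‖v‖ < δ → ∀ g : (ι → ℝ) → ℝ, (∀ y, ‖g y‖ ≤ C) →
      ‖∫ y, (φ (y + v) - φ y) * g y‖ ≤ η := by
  obtain ⟨R, hR⟩ := hsupp.isCompact.isBounded.subset_closedBall 0
  have hzero : ∀ y, R < ‖y‖ → φ y = 0 := fun y hy =>
    image_eq_zero_of_notMem_tsupport fun h => hy.not_ge (by simpa using hR h)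
  set V := volume.real (Metric.closedBall (0 : ι → ℝ) (R + 1)) with hV
  have hV0 : 0 ≤ V := measureReal_nonneg
  obtain ⟨δ, hδ, hφδ⟩ := Metric.uniformContinuous_iff.1
    (hsupp.uniformContinuous_of_continuous hφ) (η / ((|C| + 1) * (V + 1))) (by positivity)
  refine ⟨min δ 1, by positivity, fun v hv g hg => ?_⟩
  rw [lt_min_iff] at hv
  rw [← setIntegral_eq_integral_of_forall_compl_eq_zero
    (s := Metric.closedBall (0 : ι → ℝ) (R + 1)) fun y hy => ?_]
  · refine (norm_setIntegral_le_of_norm_le_const (C := η / ((|C| + 1) * (V + 1)) * (|C| + 1))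
      (isCompact_closedBall _ _).measure_lt_top fun y _ => ?_).trans ?_
    · rw [norm_mul]
      gcongr
      · simpa [dist_eq_norm] using (hφδ (a := y + v) (b := y) (by simpa using hv.1)).le
      · linarith [hg y, le_abs_self C]
    · rw [← hV]
      calc η / ((|C| + 1) * (V + 1)) * (|C| + 1) * V
          ≤ η / ((|C| + 1) * (V + 1)) * (|C| + 1) * (V + 1) := by gcongr; linarith
        _ = η := by field_simp
  · have hy' : R + 1 < ‖y‖ := by simpa using hy
    have : ‖y‖ ≤ ‖y + v‖ + ‖v‖ := by simpa using norm_sub_le (y + v) v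
    rw [hzero y (by linarith), hzero (y + v) (by linarith [hv.2])]
    simp

/-- Weak convergence of rapidly oscillating periodic functions to their cell average:
if `f : ℝ³ → ℝ` is continuous and `ℤ³`-periodic and `φ` is continuous with compact
support, then `∫ φ(x) f(x/ε) dx → (∫_{[0,1]³} f) * (∫ φ)` as `ε → 0⁺`. -/
theorem oscillating_average_convergence
    (f : (Fin 3 → ℝ) → ℝ) (hf : Continuous f)
    (hper : ∀ (y : Fin 3 → ℝ) (k : Fin 3 → ℤ), f (y + fun i => (k i : ℝ)) = f y)
    (φ : (Fin 3 → ℝ) → ℝ) (hφ : Continuous φ) (hsupp : HasCompactSupport φ) :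
    Tendsto (fun ε : ℝ => ∫ x : Fin 3 → ℝ, φ x * f (fun i => x i / ε) ∂volume)
      (nhdsWithin 0 (Set.Ioi 0))
      (nhds ((∫ y in Set.Icc (0 : Fin 3 → ℝ) 1, f y ∂volume) *
        ∫ x : Fin 3 → ℝ, φ x ∂volume)) := by
  obtain ⟨C, hC⟩ := exists_norm_le_of_continuous_periodic hf hper
  have hvol : volume.real (Set.Icc (0 : Fin 3 → ℝ) 1) = 1 := by
    simp [measureReal_def, Real.volume_Icc_pi]
  rw [Metric.tendsto_nhds]
  intro η hη
  obtain ⟨δ, hδ, hφδ⟩ :=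
    exists_forall_norm_integral_translate_sub_mul_le hφ hsupp C (half_pos hη)
  filter_upwards [Ioo_mem_nhdsGT hδ] with ε ⟨hε, hεδ⟩
  have hT : Continuous fun (y : Fin 3 → ℝ) i => y i / ε := by fun_prop
  obtain ⟨hK, hmean⟩ := setIntegral_integral_mul_periodic hf hper
    (hφ.integrable_of_hasCompactSupport hsupp) hT
  set I := ∫ x : Fin 3 → ℝ, φ x * f (fun i => x i / ε)
  have hconst : ∫ _ in Set.Icc (0 : Fin 3 → ℝ) 1, I = I := by simp [hvol]
  have hIint : IntegrableOn (fun _ => I) (Set.Icc (0 : Fin 3 → ℝ) 1) :=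
    integrableOn_const isCompact_Icc.measure_lt_top.ne
  rw [dist_eq_norm, ← hmean, ← hconst, ← integral_sub hIint hK]
  refine (norm_setIntegral_le_of_norm_le_const (C := η / 2) isCompact_Icc.measure_lt_top
    fun t ht => ?_).trans_lt (by rw [hvol]; linarith)
  have htranslate : I = ∫ y, φ (y + ε • t) * f ((fun i => y i / ε) + t) := by
    refine (integral_add_right_eq_self _ (ε • t)).symm.trans (integral_congr_ae <|
      ae_of_all _ fun y => ?_)
    have : (fun i => (y + ε • t) i / ε) = (fun i => y i / ε) + t := by
      ext i
      simp [add_div, hε.ne']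
    simp only [this]
  have hφt : HasCompactSupport fun y => φ (y + ε • t) :=
    hsupp.comp_homeomorph (Homeomorph.addRight (ε • t))
  rw [htranslate, ← integral_sub]
  · simp only [← sub_mul]
    refine hφδ _ ?_ _ fun y => hC _
    have ht1 : ‖t‖ ≤ 1 := (pi_norm_le_iff_of_nonneg zero_le_one).2 fun i => by
      rw [Real.norm_of_nonneg (ht.1 i)]
      exact ht.2 i
    rw [norm_smul, Real.norm_of_nonneg hε.le]
    nlinarith
  · exact Continuous.integrable_of_hasCompactSupport (by fun_prop) hφt.mul_right
  · exact Continuous.integrable_of_hasCompactSupport (by fun_prop) hsupp.mul_right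
end
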